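/- Let f : [0,1] → ℝ be a probability density function (nonnegative, integrable, ∫₀¹ f(p) dp = 1) with no atom at 0, and assume the regularity condition that f is continuous and monotone on some interval (0, δ) with δ > 0. Suppose there exist constants A > 0 and b > 0 such that −log(pass_D@k) is asymptotically equivalent to A·k^(−b) as k → ∞ (i.e., their ratio tends to 1). Then f(p) is asymptotically equivalent to (A/Γ(b))·p^(b−1) as p → 0⁺; that is, f(p)/((A/Γ(b))·p^(b−1)) → 1 as p → 0⁺. -/

import Mathlib

open MeasureTheory Real Filter

/-- The integral of `g((1-p)^k) (1-p)^k` against the density `f` on `[0,1]`. -/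
noncomputable def powIntegral (f : ℝ → ℝ) (k : ℕ) (g : ℝ → ℝ) : ℝ :=
  ∫ p in (0:ℝ)..1, g ((1 - p) ^ k) * ((1 - p) ^ k * f p)

/-- The integral of `g(e⁻ᵗ)` against the Gamma weight `e⁻ᵗ t^(b-1)` on `(0,∞)`. -/
noncomputable def gammaIntegral (b : ℝ) (g : ℝ → ℝ) : ℝ :=
  ∫ t in Set.Ioi (0:ℝ), g (exp (-t)) * (exp (-t) * t ^ (b - 1))

lemma one_sub_pow_mem_Icc {p : ℝ} (hp : p ∈ Set.Icc (0:ℝ) 1) (k : ℕ) :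
    (1 - p) ^ k ∈ Set.Icc (0:ℝ) 1 :=
  ⟨pow_nonneg (by linarith [hp.2]) k, pow_le_one₀ (by linarith [hp.2]) (by linarith [hp.1])⟩

lemma exp_neg_mem_Icc {t : ℝ} (ht : t ∈ Set.Ioi (0:ℝ)) : exp (-t) ∈ Set.Icc (0:ℝ) 1 :=
  ⟨(exp_pos _).le, exp_le_one_iff.2 (by linarith [Set.mem_Ioi.1 ht])⟩

lemma intervalIntegrable_comp_pow_mul {f g : ℝ → ℝ} (hf : IntervalIntegrable f volume 0 1)
    (hg : Continuous g) (k : ℕ) :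
    IntervalIntegrable (fun p => g ((1 - p) ^ k) * ((1 - p) ^ k * f p)) volume 0 1 := by
  have h : IntervalIntegrable (fun p => (g ((1 - p) ^ k) * (1 - p) ^ k) * f p) volume 0 1 :=
    hf.continuousOn_mul (by fun_prop)
  simpa only [mul_assoc] using h

lemma integrableOn_comp_exp_neg_mul {b : ℝ} (hb : 0 < b) {g : ℝ → ℝ} (hg : Continuous g) :
    IntegrableOn (fun t => g (exp (-t)) * (exp (-t) * t ^ (b - 1))) (Set.Ioi 0) := by
  obtain ⟨C, hC⟩ := isCompact_Icc.exists_bound_of_continuousOn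
    (hg.continuousOn (s := Set.Icc (0:ℝ) 1))
  refine Integrable.bdd_mul (c := C) (GammaIntegral_convergent hb)
    (by fun_prop) ?_
  filter_upwards [ae_restrict_mem measurableSet_Ioi] with t ht
  exact hC _ (exp_neg_mem_Icc ht)

lemma powIntegral_mono {f g h : ℝ → ℝ} (hf : IntervalIntegrable f volume 0 1)
    (hf_nonneg : ∀ p ∈ Set.Icc (0:ℝ) 1, 0 ≤ f p) (hg : Continuous g) (hh : Continuous h)
    (hgh : ∀ x ∈ Set.Icc (0:ℝ) 1, g x ≤ h x) (k : ℕ) :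
    powIntegral f k g ≤ powIntegral f k h :=
  intervalIntegral.integral_mono_on zero_le_one (intervalIntegrable_comp_pow_mul hf hg k)
    (intervalIntegrable_comp_pow_mul hf hh k) fun p hp =>
      mul_le_mul_of_nonneg_right (hgh _ (one_sub_pow_mem_Icc hp k))
        (mul_nonneg (one_sub_pow_mem_Icc hp k).1 (hf_nonneg p hp))

lemma powIntegral_add {f g h : ℝ → ℝ} (hf : IntervalIntegrable f volume 0 1)
    (hg : Continuous g) (hh : Continuous h) (k : ℕ) :
    powIntegral f k (fun x => g x + h x) = powIntegral f k g + powIntegral f k h := by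
  unfold powIntegral
  rw [← intervalIntegral.integral_add (intervalIntegrable_comp_pow_mul hf hg k)
    (intervalIntegrable_comp_pow_mul hf hh k)]
  simp only [add_mul]

lemma gammaIntegral_add {b : ℝ} (hb : 0 < b) {g h : ℝ → ℝ} (hg : Continuous g)
    (hh : Continuous h) :
    gammaIntegral b (fun x => g x + h x) = gammaIntegral b g + gammaIntegral b h := by
  unfold gammaIntegral
  rw [← integral_add (integrableOn_comp_exp_neg_mul hb hg) (integrableOn_comp_exp_neg_mul hb hh)]
  simp only [add_mul]

lemma gammaIntegral_mono {b : ℝ} (hb : 0 < b) {g h : ℝ → ℝ} (hg : Continuous g)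
    (hh : Continuous h) (hgh : ∀ x ∈ Set.Icc (0:ℝ) 1, g x ≤ h x) :
    gammaIntegral b g ≤ gammaIntegral b h :=
  setIntegral_mono_on (integrableOn_comp_exp_neg_mul hb hg) (integrableOn_comp_exp_neg_mul hb hh)
    measurableSet_Ioi fun _ ht => mul_le_mul_of_nonneg_right (hgh _ (exp_neg_mem_Icc ht))
      (mul_nonneg (exp_pos _).le (rpow_nonneg (Set.mem_Ioi.1 ht).le _))

lemma gammaIntegral_const_mul_pow {b : ℝ} (hb : 0 < b) (c : ℝ) (m : ℕ) :
    gammaIntegral b (fun x => c * x ^ m) = c * (((m + 1 : ℕ) : ℝ) ^ (-b) * Gamma b) := by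
  have hm : (0:ℝ) < ((m + 1 : ℕ) : ℝ) := by positivity
  have h := integral_rpow_mul_exp_neg_mul_Ioi hb hm
  rw [one_div, inv_rpow hm.le, ← rpow_neg hm.le] at h
  rw [← h, ← integral_const_mul]
  refine setIntegral_congr_fun measurableSet_Ioi fun _ _ => ?_
  have (t : ℝ) : exp (-(((m + 1 : ℕ) : ℝ) * t)) = exp (-t) ^ m * exp (-t) := by
    rw [← pow_succ, ← exp_nat_mul]; ring_nf
  simp only [this]
  ring

lemma powIntegral_const_mul_pow (f : ℝ → ℝ) (k : ℕ) (c : ℝ) (m : ℕ) :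
    powIntegral f k (fun x => c * x ^ m) =
      c * ∫ p in (0:ℝ)..1, (1 - p) ^ (k * (m + 1)) * f p := by
  unfold powIntegral
  rw [← intervalIntegral.integral_const_mul]
  congr 1
  ext p
  ring

lemma tendsto_powIntegral_polynomial {f : ℝ → ℝ} (hf : IntervalIntegrable f volume 0 1)
    {A b : ℝ} (hb : 0 < b)
    (h : Tendsto (fun k : ℕ => (k : ℝ) ^ b * ∫ p in (0:ℝ)..1, (1 - p) ^ k * f p) atTop (nhds A))
    (P : Polynomial ℝ) :
    Tendsto (fun k : ℕ => (k : ℝ) ^ b * powIntegral f k (fun x => P.eval x)) atTop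
      (nhds (A / Gamma b * gammaIntegral b (fun x => P.eval x))) := by
  induction P using Polynomial.induction_on' with
  | add P Q hP hQ =>
    simp only [Polynomial.eval_add]
    rw [gammaIntegral_add hb P.continuous Q.continuous, mul_add]
    refine (hP.add hQ).congr fun k => ?_
    rw [powIntegral_add hf P.continuous Q.continuous, mul_add]
  | monomial m c =>
    simp only [Polynomial.eval_monomial]
    have hm : (0:ℝ) < ((m + 1 : ℕ) : ℝ) := by positivity
    have hΓ : Gamma b ≠ 0 := (Gamma_pos_of_pos hb).ne'
    have h' := (h.comp (tendsto_id.atTop_mul_const' (Nat.succ_pos m))).const_mul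
      (c * ((m + 1 : ℕ) : ℝ) ^ (-b))
    rw [gammaIntegral_const_mul_pow hb]
    convert h' using 2 with k
    · simp only [Function.comp, id, powIntegral_const_mul_pow]
      rw [Nat.cast_mul, mul_rpow (Nat.cast_nonneg k) hm.le, rpow_neg hm.le]
      have := (rpow_pos_of_pos hm b).ne'
      simp only [Nat.succ_eq_add_one]
      field_simp
    · field_simp

lemma eventually_lt_powIntegral {f : ℝ → ℝ} (hf : IntervalIntegrable f volume 0 1)
    (hf_nonneg : ∀ p ∈ Set.Icc (0:ℝ) 1, 0 ≤ f p) {A b : ℝ} (hA : 0 ≤ A) (hb : 0 < b)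
    (h : Tendsto (fun k : ℕ => (k : ℝ) ^ b * ∫ p in (0:ℝ)..1, (1 - p) ^ k * f p) atTop (nhds A))
    {g : ℝ → ℝ} (hg : Continuous g) {a : ℝ} (ha : a < A / Gamma b * gammaIntegral b g) :
    ∀ᶠ k : ℕ in atTop, a < (k : ℝ) ^ b * powIntegral f k g := by
  have hΓ : 0 < Gamma b := Gamma_pos_of_pos hb
  obtain ⟨c, hc, hac⟩ : ∃ c > 0, A * c < A / Gamma b * gammaIntegral b g - a := by
    refine ⟨(A / Gamma b * gammaIntegral b g - a) / (A + 1), by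
      apply div_pos <;> linarith, ?_⟩
    rw [← mul_div_assoc, div_lt_iff₀ (by linarith)]
    nlinarith
  obtain ⟨P, hP⟩ := exists_polynomial_near_of_continuousOn 0 1 g hg.continuousOn (c / 2)
    (by positivity)
  set Q := P - Polynomial.C (c / 2) with hQ
  have hQg (x : ℝ) (hx : x ∈ Set.Icc (0:ℝ) 1) : Q.eval x ≤ g x ∧ g x ≤ Q.eval x + c := by
    have := abs_lt.1 (hP x hx)
    simp only [hQ, Polynomial.eval_sub, Polynomial.eval_C]
    constructor <;> linarith
  have h1 : gammaIntegral b g ≤ gammaIntegral b (fun x => Q.eval x + c) :=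
    gammaIntegral_mono hb hg (by fun_prop) fun x hx => (hQg x hx).2
  have hconst : gammaIntegral b (fun _ => c) = c * Gamma b := by
    simpa using gammaIntegral_const_mul_pow hb c 0
  rw [gammaIntegral_add hb (by fun_prop) continuous_const, hconst] at h1
  have h2 := mul_le_mul_of_nonneg_left h1 (div_nonneg hA hΓ.le)
  have h3 : A / Gamma b * (c * Gamma b) = A * c := by field_simp
  rw [mul_add, h3] at h2
  filter_upwards [(tendsto_powIntegral_polynomial hf hb h Q).eventually_const_lt
    (show a < _ by linarith)] with k hk
  exact hk.trans_le (mul_le_mul_of_nonneg_left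
    (powIntegral_mono hf hf_nonneg (by fun_prop) hg (fun x hx => (hQg x hx).1) k) (by positivity))

/-- **Karamata's theorem** for densities on `[0,1]`: the asymptotics of the moments of `1 - p`
determine those of integrals of continuous functions of `(1 - p)^k`. -/
theorem tendsto_powIntegral {f : ℝ → ℝ} (hf : IntervalIntegrable f volume 0 1)
    (hf_nonneg : ∀ p ∈ Set.Icc (0:ℝ) 1, 0 ≤ f p) {A b : ℝ} (hA : 0 ≤ A) (hb : 0 < b)
    (h : Tendsto (fun k : ℕ => (k : ℝ) ^ b * ∫ p in (0:ℝ)..1, (1 - p) ^ k * f p) atTop (nhds A))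
    {g : ℝ → ℝ} (hg : Continuous g) :
    Tendsto (fun k : ℕ => (k : ℝ) ^ b * powIntegral f k g) atTop
      (nhds (A / Gamma b * gammaIntegral b g)) := by
  refine tendsto_order.2 ⟨fun a ha => eventually_lt_powIntegral hf hf_nonneg hA hb h hg ha,
    fun a ha => ?_⟩
  have hneg : gammaIntegral b (-g) = -gammaIntegral b g := by
    simp only [gammaIntegral, Pi.neg_apply, neg_mul, integral_neg]
  filter_upwards [eventually_lt_powIntegral hf hf_nonneg hA hb h hg.neg (a := -a)
    (by rw [hneg]; linarith)] with k hk
  have : powIntegral f k (-g) = -powIntegral f k g := by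
    simp only [powIntegral, Pi.neg_apply, neg_mul, intervalIntegral.integral_neg]
  rw [this] at hk
  linarith

lemma tendsto_powIntegral_one {g : ℝ → ℝ} (hg : Continuous g) :
    Tendsto (fun k : ℕ => (k : ℝ) * powIntegral (fun _ => 1) k g) atTop
      (nhds (gammaIntegral 1 g)) := by
  have h : Tendsto (fun k : ℕ => (k : ℝ) ^ (1:ℝ) * ∫ p in (0:ℝ)..1, (1 - p) ^ k * (1:ℝ)) atTop
      (nhds 1) := by
    refine (tendsto_natCast_div_add_atTop (1:ℝ)).congr fun k => ?_
    have : ∫ p in (0:ℝ)..1, (1 - p) ^ k = 1 / ((k : ℝ) + 1) := by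
      rw [intervalIntegral.integral_comp_sub_left (fun x => x ^ k), integral_pow]
      simp
    simp only [mul_one, rpow_one, this]
    ring
  simpa using tendsto_powIntegral intervalIntegrable_const (fun _ _ => zero_le_one) zero_le_one
    one_pos h hg

/-- A continuous bump function supported on `[x₀, x₁]`. -/
noncomputable def bump (x₀ x₁ x : ℝ) : ℝ := max 0 ((x - x₀) * (x₁ - x))

lemma continuous_bump (x₀ x₁ : ℝ) : Continuous (bump x₀ x₁) := by
  unfold bump
  fun_prop

lemma bump_nonneg (x₀ x₁ x : ℝ) : 0 ≤ bump x₀ x₁ x := le_max_left _ _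

lemma bump_pos {x₀ x₁ x : ℝ} (hx : x ∈ Set.Ioo x₀ x₁) : 0 < bump x₀ x₁ x :=
  lt_max_of_lt_right (mul_pos (sub_pos.2 hx.1) (sub_pos.2 hx.2))

lemma bump_eq_zero {x₀ x₁ x : ℝ} (h : x₀ < x₁) (hx : x ∉ Set.Ioo x₀ x₁) : bump x₀ x₁ x = 0 := by
  refine max_eq_left ?_
  by_contra! hpos
  refine hx ⟨?_, ?_⟩ <;> by_contra! <;> nlinarith

lemma exp_neg_mem_Ioo_iff {t t₀ t₁ : ℝ} :
    exp (-t) ∈ Set.Ioo (exp (-t₁)) (exp (-t₀)) ↔ t ∈ Set.Ioo t₀ t₁ := by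
  simp [and_comm]

lemma gammaIntegral_bump_pos {t₀ t₁ : ℝ} (h₀ : 0 < t₀) (h : t₀ < t₁) :
    0 < gammaIntegral 1 (bump (exp (-t₁)) (exp (-t₀))) := by
  unfold gammaIntegral
  rw [setIntegral_pos_iff_support_of_nonneg_ae]
  · refine lt_of_lt_of_le (b := volume (Set.Ioo t₀ t₁)) (by simpa using h)
      (measure_mono fun t ht => ⟨?_, h₀.trans ht.1⟩)
    have := bump_pos (exp_neg_mem_Ioo_iff.2 ht)
    have h2 := exp_pos (-t)
    simp [this.ne']
  · refine Eventually.of_forall fun t => ?_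
    have := bump_nonneg (exp (-t₁)) (exp (-t₀)) (exp (-t))
    have h2 := exp_pos (-t)
    simp only [sub_self, rpow_zero, mul_one, Pi.zero_apply]
    positivity
  · exact integrableOn_comp_exp_neg_mul one_pos (continuous_bump _ _)

lemma gammaIntegral_bump_le {b t₀ t₁ r : ℝ} (hb : 0 < b) (h : t₀ < t₁)
    (hr : ∀ t ∈ Set.Ioo t₀ t₁, t ^ (b - 1) ≤ r) :
    gammaIntegral b (bump (exp (-t₁)) (exp (-t₀))) ≤
      r * gammaIntegral 1 (bump (exp (-t₁)) (exp (-t₀))) := by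
  unfold gammaIntegral
  rw [← integral_const_mul]
  refine setIntegral_mono_on (integrableOn_comp_exp_neg_mul hb (continuous_bump _ _))
    ((integrableOn_comp_exp_neg_mul one_pos (continuous_bump _ _)).const_mul r)
    measurableSet_Ioi fun t _ => ?_
  by_cases ht : t ∈ Set.Ioo t₀ t₁
  · have := mul_le_mul_of_nonneg_left (hr t ht)
      (mul_nonneg (bump_nonneg (exp (-t₁)) (exp (-t₀)) (exp (-t))) (exp_pos (-t)).le)
    simp only [sub_self, rpow_zero, mul_one]
    linarith
  · simp [bump_eq_zero (exp_lt_exp.2 (neg_lt_neg h)) (mt exp_neg_mem_Ioo_iff.1 ht)]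

lemma le_gammaIntegral_bump {b t₀ t₁ r : ℝ} (hb : 0 < b) (h : t₀ < t₁)
    (hr : ∀ t ∈ Set.Ioo t₀ t₁, r ≤ t ^ (b - 1)) :
    r * gammaIntegral 1 (bump (exp (-t₁)) (exp (-t₀))) ≤
      gammaIntegral b (bump (exp (-t₁)) (exp (-t₀))) := by
  unfold gammaIntegral
  rw [← integral_const_mul]
  refine setIntegral_mono_on
    ((integrableOn_comp_exp_neg_mul one_pos (continuous_bump _ _)).const_mul r)
    (integrableOn_comp_exp_neg_mul hb (continuous_bump _ _)) measurableSet_Ioi fun t _ => ?_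
  by_cases ht : t ∈ Set.Ioo t₀ t₁
  · have := mul_le_mul_of_nonneg_left (hr t ht)
      (mul_nonneg (bump_nonneg (exp (-t₁)) (exp (-t₀)) (exp (-t))) (exp_pos (-t)).le)
    simp only [sub_self, rpow_zero, mul_one]
    linarith
  · simp [bump_eq_zero (exp_lt_exp.2 (neg_lt_neg h)) (mt exp_neg_mem_Ioo_iff.1 ht)]

lemma mul_powIntegral_one_le {f : ℝ → ℝ} (hf : IntervalIntegrable f volume 0 1) {y x₀ x₁ : ℝ}
    (hx : x₀ < x₁) {k : ℕ}
    (hy : ∀ q ∈ Set.Icc (0:ℝ) 1, (1 - q) ^ k ∈ Set.Ioo x₀ x₁ → y ≤ f q) :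
    y * powIntegral (fun _ => 1) k (bump x₀ x₁) ≤ powIntegral f k (bump x₀ x₁) := by
  unfold powIntegral
  rw [← intervalIntegral.integral_const_mul]
  refine intervalIntegral.integral_mono_on zero_le_one
    ((intervalIntegrable_comp_pow_mul intervalIntegrable_const (continuous_bump _ _) k).const_mul y)
    (intervalIntegrable_comp_pow_mul hf (continuous_bump _ _) k) fun q hq => ?_
  by_cases hqx : (1 - q) ^ k ∈ Set.Ioo x₀ x₁
  · have := mul_le_mul_of_nonneg_left (hy q hq hqx)
      (mul_nonneg (bump_nonneg x₀ x₁ ((1 - q) ^ k)) (one_sub_pow_mem_Icc hq k).1)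
    linarith
  · simp [bump_eq_zero hx hqx]

lemma powIntegral_le_mul {f : ℝ → ℝ} (hf : IntervalIntegrable f volume 0 1) {y x₀ x₁ : ℝ}
    (hx : x₀ < x₁) {k : ℕ}
    (hy : ∀ q ∈ Set.Icc (0:ℝ) 1, (1 - q) ^ k ∈ Set.Ioo x₀ x₁ → f q ≤ y) :
    powIntegral f k (bump x₀ x₁) ≤ y * powIntegral (fun _ => 1) k (bump x₀ x₁) := by
  have h := mul_powIntegral_one_le (f := fun q => -f q) hf.neg (y := -y) hx
    fun q hq hqx => neg_le_neg (hy q hq hqx)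
  have hneg : powIntegral (fun q => -f q) k (bump x₀ x₁) = -powIntegral f k (bump x₀ x₁) := by
    simp only [powIntegral, mul_neg, intervalIntegral.integral_neg]
  rw [hneg] at h
  linarith

lemma eventually_rpow_mul_lt {f : ℝ → ℝ} (hf : IntervalIntegrable f volume 0 1)
    (hf_nonneg : ∀ p ∈ Set.Icc (0:ℝ) 1, 0 ≤ f p) {A b : ℝ} (hA : 0 ≤ A) (hb : 0 < b)
    (h : Tendsto (fun k : ℕ => (k : ℝ) ^ b * ∫ p in (0:ℝ)..1, (1 - p) ^ k * f p) atTop (nhds A))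
    {K : ℝ → ℕ} {l : Filter ℝ} (hK : Tendsto K l atTop) {t₀ t₁ r a : ℝ} (h₀ : 0 < t₀)
    (h₁ : t₀ < t₁) (hr : ∀ t ∈ Set.Ioo t₀ t₁, t ^ (b - 1) ≤ r) (ha : A / Gamma b * r < a)
    (hcmp : ∀ᶠ p in l, ∀ q ∈ Set.Icc (0:ℝ) 1,
      (1 - q) ^ K p ∈ Set.Ioo (exp (-t₁)) (exp (-t₀)) → f p ≤ f q) :
    ∀ᶠ p in l, (K p : ℝ) ^ (b - 1) * f p < a := by
  have hΓ : 0 < Gamma b := Gamma_pos_of_pos hb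
  have hx : exp (-t₁) < exp (-t₀) := exp_lt_exp.2 (neg_lt_neg h₁)
  set g := bump (exp (-t₁)) (exp (-t₀))
  have hg : Continuous g := continuous_bump _ _
  have hpos : 0 < gammaIntegral 1 g := gammaIntegral_bump_pos h₀ h₁
  have hS := (tendsto_powIntegral_one hg).comp hK
  have hT := (tendsto_powIntegral hf hf_nonneg hA hb h hg).comp hK
  have hlim : A / Gamma b * gammaIntegral b g < a * gammaIntegral 1 g := by
    have := mul_le_mul_of_nonneg_left (gammaIntegral_bump_le hb h₁ hr) (div_nonneg hA hΓ.le)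
    nlinarith
  filter_upwards [hcmp, hK.eventually_gt_atTop 0, hS.eventually_const_lt hpos,
    hT.eventually_lt (hS.const_mul a) hlim] with p hp hKp hSp hTp
  simp only [Function.comp] at hSp hTp
  have hKp' : (0:ℝ) < K p := Nat.cast_pos.2 hKp
  have h2 := mul_le_mul_of_nonneg_left (mul_powIntegral_one_le hf hx hp)
    (rpow_pos_of_pos hKp' b).le
  have h3 : (K p : ℝ) ^ b = (K p : ℝ) ^ (b - 1) * K p := by
    rw [rpow_sub_one hKp'.ne']; field_simp
  refine lt_of_mul_lt_mul_right (lt_of_le_of_lt ?_ hTp) hSp.le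
  refine le_of_eq_of_le ?_ h2
  rw [h3]
  ring

lemma eventually_lt_rpow_mul {f : ℝ → ℝ} (hf : IntervalIntegrable f volume 0 1)
    (hf_nonneg : ∀ p ∈ Set.Icc (0:ℝ) 1, 0 ≤ f p) {A b : ℝ} (hA : 0 ≤ A) (hb : 0 < b)
    (h : Tendsto (fun k : ℕ => (k : ℝ) ^ b * ∫ p in (0:ℝ)..1, (1 - p) ^ k * f p) atTop (nhds A))
    {K : ℝ → ℕ} {l : Filter ℝ} (hK : Tendsto K l atTop) {t₀ t₁ r a : ℝ} (h₀ : 0 < t₀)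
    (h₁ : t₀ < t₁) (hr : ∀ t ∈ Set.Ioo t₀ t₁, r ≤ t ^ (b - 1)) (ha : a < A / Gamma b * r)
    (hcmp : ∀ᶠ p in l, ∀ q ∈ Set.Icc (0:ℝ) 1,
      (1 - q) ^ K p ∈ Set.Ioo (exp (-t₁)) (exp (-t₀)) → f q ≤ f p) :
    ∀ᶠ p in l, a < (K p : ℝ) ^ (b - 1) * f p := by
  have hΓ : 0 < Gamma b := Gamma_pos_of_pos hb
  have hx : exp (-t₁) < exp (-t₀) := exp_lt_exp.2 (neg_lt_neg h₁)
  set g := bump (exp (-t₁)) (exp (-t₀))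
  have hg : Continuous g := continuous_bump _ _
  have hpos : 0 < gammaIntegral 1 g := gammaIntegral_bump_pos h₀ h₁
  have hS := (tendsto_powIntegral_one hg).comp hK
  have hT := (tendsto_powIntegral hf hf_nonneg hA hb h hg).comp hK
  have hlim : a * gammaIntegral 1 g < A / Gamma b * gammaIntegral b g := by
    have := mul_le_mul_of_nonneg_left (le_gammaIntegral_bump hb h₁ hr) (div_nonneg hA hΓ.le)
    nlinarith
  filter_upwards [hcmp, hK.eventually_gt_atTop 0, hS.eventually_const_lt hpos,
    (hS.const_mul a).eventually_lt hT hlim] with p hp hKp hSp hTp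
  simp only [Function.comp] at hSp hTp
  have hKp' : (0:ℝ) < K p := Nat.cast_pos.2 hKp
  have h2 := mul_le_mul_of_nonneg_left (powIntegral_le_mul hf hx hp)
    (rpow_pos_of_pos hKp' b).le
  have h3 : (K p : ℝ) ^ b = (K p : ℝ) ^ (b - 1) * K p := by
    rw [rpow_sub_one hKp'.ne']; field_simp
  refine lt_of_mul_lt_mul_right (lt_of_lt_of_le hTp ?_) hSp.le
  refine le_of_le_of_eq h2 ?_
  rw [h3]
  ring

lemma tendsto_floor_inv_nhdsGT_zero :
    Tendsto (fun p : ℝ => ⌊p⁻¹⌋₊) (nhdsWithin 0 (Set.Ioi 0)) atTop :=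
  tendsto_nat_floor_atTop.comp tendsto_inv_nhdsGT_zero

lemma tendsto_floor_inv_mul_nhdsGT_zero :
    Tendsto (fun p : ℝ => (⌊p⁻¹⌋₊ : ℝ) * p) (nhdsWithin 0 (Set.Ioi 0)) (nhds 1) :=
  ((tendsto_nat_floor_div_atTop (R := ℝ)).comp tendsto_inv_nhdsGT_zero).congr fun p => by simp

lemma tendsto_one_sub_pow_floor_inv :
    Tendsto (fun p : ℝ => (1 - p) ^ ⌊p⁻¹⌋₊) (nhdsWithin 0 (Set.Ioi 0)) (nhds (exp (-1))) := by
  have hd : HasDerivAt (fun p : ℝ => log (1 - p)) (-1) 0 := by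
    simpa using ((hasDerivAt_id (0:ℝ)).const_sub 1).log (by simp)
  have hs : Tendsto (dslope (fun p : ℝ => log (1 - p)) 0) (nhdsWithin 0 (Set.Ioi 0))
      (nhds (-1)) := by
    have := (continuousAt_dslope_same.2 hd.differentiableAt).tendsto
    rw [dslope_same, hd.deriv] at this
    exact this.mono_left nhdsWithin_le_nhds
  have h := (tendsto_floor_inv_mul_nhdsGT_zero.mul hs).rexp
  rw [one_mul] at h
  refine h.congr' ?_
  filter_upwards [Ioo_mem_nhdsGT (zero_lt_one' ℝ)] with p hp
  have h1 := sub_smul_dslope (fun p : ℝ => log (1 - p)) 0 p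
  simp only [sub_zero, log_one, smul_eq_mul] at h1
  rw [mul_assoc, h1, exp_nat_mul, exp_log (by linarith [hp.2])]

lemma eventually_mem_Ioo_of_one_lt {t₀ δ : ℝ} (t₁ : ℝ) (h₀ : 1 < t₀) (hδ : 0 < δ) :
    ∀ᶠ p in nhdsWithin (0:ℝ) (Set.Ioi 0), ∀ q ∈ Set.Icc (0:ℝ) 1,
      (1 - q) ^ ⌊p⁻¹⌋₊ ∈ Set.Ioo (exp (-t₁)) (exp (-t₀)) → q ∈ Set.Ioo p δ := by
  have hmin : 0 < min δ 1 := lt_min hδ one_pos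
  have hz := (tendsto_pow_atTop_nhds_zero_of_lt_one (r := 1 - min δ 1)
    (by linarith [min_le_right δ 1]) (by linarith)).comp tendsto_floor_inv_nhdsGT_zero
  filter_upwards [hz.eventually_lt_const (exp_pos (-t₁)), Ioo_mem_nhdsGT (zero_lt_one' ℝ),
    tendsto_one_sub_pow_floor_inv.eventually_const_lt
      (exp_lt_exp.2 (neg_lt_neg h₀))] with p h1 hp h2 q hq hqx
  simp only [Function.comp] at h1
  constructor
  · by_contra! hqp
    have := pow_le_pow_left₀ (by linarith [hp.2]) (show 1 - p ≤ 1 - q by linarith) ⌊p⁻¹⌋₊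
    linarith [hqx.2]
  · by_contra! hqδ
    have := pow_le_pow_left₀ (by linarith [hq.2])
      (show 1 - q ≤ 1 - min δ 1 by linarith [min_le_left δ 1]) ⌊p⁻¹⌋₊
    linarith [hqx.1]

lemma eventually_mem_Ioo_of_lt_one {t₀ t₁ : ℝ} (h₀ : 0 < t₀) (h₁ : t₁ < 1) :
    ∀ᶠ p in nhdsWithin (0:ℝ) (Set.Ioi 0), ∀ q ∈ Set.Icc (0:ℝ) 1,
      (1 - q) ^ ⌊p⁻¹⌋₊ ∈ Set.Ioo (exp (-t₁)) (exp (-t₀)) → q ∈ Set.Ioo 0 p := by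
  filter_upwards [tendsto_one_sub_pow_floor_inv.eventually_lt_const
      (exp_lt_exp.2 (neg_lt_neg h₁))] with p h2 q hq hqx
  constructor
  · refine hq.1.lt_of_ne ?_
    rintro rfl
    have := hqx.2
    rw [sub_zero, one_pow, one_lt_exp_iff] at this
    linarith
  · by_contra! hqp
    have := pow_le_pow_left₀ (by linarith [hq.2]) (show 1 - q ≤ 1 - p by linarith) ⌊p⁻¹⌋₊
    linarith [hqx.1]

lemma exists_Ioo_of_eventually_nhds_one {P : ℝ → Prop} (h : ∀ᶠ t in nhds (1:ℝ), P t) :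
    (∃ t₀ t₁, 1 < t₀ ∧ t₀ < t₁ ∧ ∀ t ∈ Set.Ioo t₀ t₁, P t) ∧
      ∃ t₀ t₁, 0 < t₀ ∧ t₀ < t₁ ∧ t₁ < 1 ∧ ∀ t ∈ Set.Ioo t₀ t₁, P t := by
  obtain ⟨l, u, ⟨hl, hu⟩, hP⟩ := mem_nhds_iff_exists_Ioo_subset.1 h
  constructor
  · obtain ⟨t₀, h0, h0u⟩ := exists_between hu
    exact ⟨t₀, u, h0, h0u, fun t ht => hP ⟨by linarith [ht.1], ht.2⟩⟩
  · obtain ⟨t₀, h0, h0u⟩ := exists_between (max_lt hl one_pos)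
    obtain ⟨t₁, h1, h1u⟩ := exists_between h0u
    have := max_lt_iff.1 h0
    exact ⟨t₀, t₁, this.2, h1, h1u, fun t ht => hP ⟨by linarith [ht.1], by linarith [ht.2]⟩⟩

/-- If `f` is monotone near `0` and its `k`-th moments of `1 - p` are asymptotic to `A k⁻ᵇ`, then
`f p ~ A / Γ(b) * ⌊1/p⌋^(1-b)` as `p → 0⁺`. -/
theorem tendsto_floor_inv_rpow_mul {f : ℝ → ℝ} (hf : IntervalIntegrable f volume 0 1)
    (hf_nonneg : ∀ p ∈ Set.Icc (0:ℝ) 1, 0 ≤ f p) {δ : ℝ} (hδ : 0 < δ)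
    (hf_mono : MonotoneOn f (Set.Ioo 0 δ) ∨ AntitoneOn f (Set.Ioo 0 δ))
    {A b : ℝ} (hA : 0 < A) (hb : 0 < b)
    (h : Tendsto (fun k : ℕ => (k : ℝ) ^ b * ∫ p in (0:ℝ)..1, (1 - p) ^ k * f p) atTop
      (nhds A)) :
    Tendsto (fun p : ℝ => (⌊p⁻¹⌋₊ : ℝ) ^ (b - 1) * f p) (nhdsWithin 0 (Set.Ioi 0))
      (nhds (A / Gamma b)) := by
  have hC : 0 < A / Gamma b := div_pos hA (Gamma_pos_of_pos hb)
  have hK := tendsto_floor_inv_nhdsGT_zero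
  have hcont : Tendsto (fun t : ℝ => t ^ (b - 1)) (nhds 1) (nhds 1) := by
    simpa using (continuousAt_rpow_const 1 (b - 1) (Or.inl one_ne_zero)).tendsto
  have hmem := Ioo_mem_nhdsGT hδ
  refine tendsto_order.2 ⟨fun a ha => ?_, fun a ha => ?_⟩
  · obtain ⟨r, har, hr⟩ := exists_between ((div_lt_one hC).2 ha)
    rw [div_lt_iff₀' hC] at har
    obtain ⟨⟨t₀, t₁, h0, h1, hright⟩, s₀, s₁, hs0, hs1, hs, hleft⟩ :=
      exists_Ioo_of_eventually_nhds_one (hcont.eventually_const_lt hr)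
    rcases hf_mono with hm | hm
    · refine eventually_lt_rpow_mul hf hf_nonneg hA.le hb h hK hs0 hs1
        (fun t ht => (hleft t ht).le) har ?_
      filter_upwards [eventually_mem_Ioo_of_lt_one hs0 hs, hmem] with p h1 hp q hq hqx
      have := h1 q hq hqx
      exact hm ⟨this.1, this.2.trans hp.2⟩ hp this.2.le
    · refine eventually_lt_rpow_mul hf hf_nonneg hA.le hb h hK (one_pos.trans h0) h1
        (fun t ht => (hright t ht).le) har ?_
      filter_upwards [eventually_mem_Ioo_of_one_lt t₁ h0 hδ, hmem] with p h1 hp q hq hqx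
      have := h1 q hq hqx
      exact hm hp ⟨hp.1.trans this.1, this.2⟩ this.1.le
  · obtain ⟨r, hr, har⟩ := exists_between ((one_lt_div hC).2 ha)
    rw [lt_div_iff₀' hC] at har
    obtain ⟨⟨t₀, t₁, h0, h1, hright⟩, s₀, s₁, hs0, hs1, hs, hleft⟩ :=
      exists_Ioo_of_eventually_nhds_one (hcont.eventually_lt_const hr)
    rcases hf_mono with hm | hm
    · refine eventually_rpow_mul_lt hf hf_nonneg hA.le hb h hK (one_pos.trans h0) h1
        (fun t ht => (hright t ht).le) har ?_
      filter_upwards [eventually_mem_Ioo_of_one_lt t₁ h0 hδ, hmem] with p h1 hp q hq hqx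
      have := h1 q hq hqx
      exact hm hp ⟨hp.1.trans this.1, this.2⟩ this.1.le
    · refine eventually_rpow_mul_lt hf hf_nonneg hA.le hb h hK hs0 hs1
        (fun t ht => (hleft t ht).le) har ?_
      filter_upwards [eventually_mem_Ioo_of_lt_one hs0 hs, hmem] with p h1 hp q hq hqx
      have := h1 q hq hqx
      exact hm ⟨this.1, this.2.trans hp.2⟩ hp this.2.le

/-- If `-log (1 - u k) ~ A k⁻ᵇ` with `u k ≤ 1`, then `u k ~ A k⁻ᵇ`. -/
lemma tendsto_rpow_mul_of_neg_log_one_sub {u : ℕ → ℝ} (hu : ∀ k, u k ≤ 1) {A b : ℝ} (hA : 0 < A)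
    (hb : 0 < b)
    (h : Tendsto (fun k : ℕ => -log (1 - u k) / (A * (k : ℝ) ^ (-b))) atTop (nhds 1)) :
    Tendsto (fun k : ℕ => (k : ℝ) ^ b * u k) atTop (nhds A) := by
  have hkL : Tendsto (fun k : ℕ => (k : ℝ) ^ b * -log (1 - u k)) atTop (nhds A) := by
    have := h.const_mul A
    rw [mul_one] at this
    refine this.congr' ?_
    filter_upwards [eventually_gt_atTop 0] with k hk
    have hk' := rpow_pos_of_pos (Nat.cast_pos (α := ℝ).2 hk) b
    rw [rpow_neg (Nat.cast_nonneg k)]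
    field_simp
  have hL : Tendsto (fun k : ℕ => -log (1 - u k)) atTop (nhds 0) := by
    have := ((tendsto_rpow_neg_atTop hb).comp tendsto_natCast_atTop_atTop).mul hkL
    rw [zero_mul] at this
    refine this.congr' ?_
    filter_upwards [eventually_gt_atTop 0] with k hk
    have hk' := rpow_pos_of_pos (Nat.cast_pos (α := ℝ).2 hk) b
    simp only [Function.comp]
    rw [rpow_neg (Nat.cast_nonneg k)]
    field_simp
  have hd : HasDerivAt (fun x : ℝ => 1 - exp (-x)) 1 0 := by
    simpa using ((hasDerivAt_id (0:ℝ)).neg.exp).const_sub 1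
  have hs := (continuousAt_dslope_same.2 hd.differentiableAt).tendsto
  rw [dslope_same, hd.deriv] at hs
  have hmul := hkL.mul (hs.comp hL)
  rw [mul_one] at hmul
  refine hmul.congr' ?_
  filter_upwards [h.eventually_const_lt one_pos] with k hk
  have hne : 1 - u k ≠ 0 := by
    intro h0
    simp [h0] at hk
  have h1 := sub_smul_dslope (fun x : ℝ => 1 - exp (-x)) 0 (-log (1 - u k))
  simp only [sub_zero, neg_zero, exp_zero, sub_self, smul_eq_mul, neg_neg] at h1
  rw [exp_log (lt_of_le_of_ne (by linarith [hu k]) hne.symm)] at h1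
  simp only [Function.comp]
  rw [mul_assoc, h1]
  ring

/-- **Necessity of a power-law left tail in the distribution of single-attempt
success rates.** Let `f` be a probability density on `[0,1]` that is continuous
and monotone on some interval `(0, δ)`. If
`-log(pass_D@k) ~ A·k^(-b)` as `k → ∞`, where
`pass_D@k = 1 - ∫₀¹ (1-p)^k f(p) dp`, then
`f(p) ~ (A/Γ(b))·p^(b-1)` as `p → 0⁺`. -/
theorem density_power_law_left_tail_of_neg_log_pass
    (f : ℝ → ℝ)
    (hf_nonneg : ∀ p ∈ Set.Icc (0:ℝ) 1, 0 ≤ f p)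
    (hf_int : IntervalIntegrable f volume 0 1)
    (hf_prob : (∫ p in (0:ℝ)..1, f p) = 1)
    (δ : ℝ) (hδ : 0 < δ)
    (hf_cont : ContinuousOn f (Set.Ioo 0 δ))
    (hf_mono : MonotoneOn f (Set.Ioo 0 δ) ∨ AntitoneOn f (Set.Ioo 0 δ))
    (A b : ℝ) (hA : 0 < A) (hb : 0 < b)
    (h_pass : Tendsto
      (fun k : ℕ =>
        (-Real.log (1 - ∫ p in (0:ℝ)..1, (1 - p) ^ k * f p)) / (A * (k : ℝ) ^ (-b)))
      atTop (nhds 1)) :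
    Tendsto (fun p : ℝ => f p / ((A / Real.Gamma b) * p ^ (b - 1)))
      (nhdsWithin 0 (Set.Ioi 0)) (nhds 1) := by
  have hle (k : ℕ) : ∫ p in (0:ℝ)..1, (1 - p) ^ k * f p ≤ 1 := by
    refine le_of_le_of_eq ?_ hf_prob
    refine intervalIntegral.integral_mono_on zero_le_one
      (hf_int.continuousOn_mul (g := fun p => (1 - p) ^ k) (by fun_prop)) hf_int fun p hp => ?_
    exact mul_le_of_le_one_left (hf_nonneg p hp) (one_sub_pow_mem_Icc hp k).2
  have hC : A / Real.Gamma b ≠ 0 := (div_pos hA (Gamma_pos_of_pos hb)).ne'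
  have hF := tendsto_floor_inv_rpow_mul hf_int hf_nonneg hδ hf_mono hA hb
    (tendsto_rpow_mul_of_neg_log_one_sub hle hA hb h_pass)
  have hpow := (tendsto_floor_inv_mul_nhdsGT_zero.rpow_const (p := b - 1)
    (Or.inl one_ne_zero)).const_mul (A / Real.Gamma b)
  rw [one_rpow, mul_one] at hpow
  have h := hF.div hpow hC
  rw [div_self hC] at h
  refine h.congr' ?_
  filter_upwards [self_mem_nhdsWithin,
    tendsto_floor_inv_nhdsGT_zero.eventually_gt_atTop 0] with p hp hk
  have hk' := (rpow_pos_of_pos (Nat.cast_pos (α := ℝ).2 hk) (b - 1)).ne'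
  simp only [Pi.div_apply]
  rw [mul_rpow (Nat.cast_nonneg _) (Set.mem_Ioi.1 hp).le, mul_left_comm,
    mul_div_mul_left _ _ hk']
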